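/- arXiv:1702.06075 — 3 statements merged into one kernel-verified Lean document; each statement's English description precedes it below -/
import Mathlib

section
/- Global asymptotic stability of the closed-loop momentum-error system (Theorem 1): for any symmetric positive definite matrices K_P, K_D, K_O ∈ ℝ^{6×6}, the origin (I, h̃, ξ̃) = (0, 0, 0) is a globally asymptotically stable equilibrium of the closed-loop momentum-error system; i.e., every solution (I, h̃, ξ̃) : [0,∞) → ℝ⁶ × ℝ⁶ × ℝ⁶ satisfies (I(t), h̃(t), ξ̃(t)) → (0,0,0) as t → ∞, and moreover for every ε > 0 there is η > 0 such that any solution with ‖(I(0), h̃(0), ξ̃(0))‖ < η satisfies ‖(I(t), h̃(t), ξ̃(t))‖ < ε for all t ≥ 0. -/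
open Filter Matrix

/-- Action of a `6 × 6` real matrix on `ℝ⁶` (Euclidean space) by matrix–vector
multiplication. -/
noncomputable def act (K : Matrix (Fin 6) (Fin 6) ℝ) (x : EuclideanSpace ℝ (Fin 6)) :
    EuclideanSpace ℝ (Fin 6) :=
  Matrix.toEuclideanLin K x

/-- `(I, h̃, ξ̃)` is a solution of the closed-loop momentum-error system
`I' = h̃`, `h̃' = ξ̃ − K_D h̃ − K_P I`, `ξ̃' = −ξ̃ − K_O⁻¹ h̃` on `[0, ∞)`. -/
def IsClosedLoopSolution (KP KD KO : Matrix (Fin 6) (Fin 6) ℝ)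
    (I h ξ : ℝ → EuclideanSpace ℝ (Fin 6)) : Prop :=
  (∀ t : ℝ, 0 ≤ t → HasDerivAt I (h t) t) ∧
  (∀ t : ℝ, 0 ≤ t → HasDerivAt h (ξ t - act KD (h t) - act KP (I t)) t) ∧
  (∀ t : ℝ, 0 ≤ t → HasDerivAt ξ (-ξ t - act KO⁻¹ (h t)) t)

open scoped RealInnerProductSpace

/-- A real function with `V' ≤ -k V` on `[0, ∞)` decays exponentially there. -/
theorem le_mul_exp_neg_of_deriv_le {V V' : ℝ → ℝ} {k : ℝ}
    (hV : ∀ t, 0 ≤ t → HasDerivAt V (V' t) t) (hle : ∀ t, 0 ≤ t → V' t ≤ -k * V t)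
    {t : ℝ} (ht : 0 ≤ t) : V t ≤ V 0 * Real.exp (-k * t) := by
  have hderiv : ∀ s, 0 ≤ s → HasDerivAt (fun s => V s * Real.exp (k * s))
      (V' s * Real.exp (k * s) + V s * (Real.exp (k * s) * k)) s := fun s hs => by
    have hlin : HasDerivAt (fun s : ℝ => k * s) k s := by
      simpa using (hasDerivAt_id s).const_mul k
    exact (hV s hs).mul hlin.exp
  have hanti : AntitoneOn (fun s => V s * Real.exp (k * s)) (Set.Ici 0) := by
    refine antitoneOn_of_hasDerivWithinAt_nonpos (convex_Ici 0)
      (fun s hs => (hderiv s hs).continuousAt.continuousWithinAt)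
      (fun s hs => (hderiv s (interior_subset hs)).hasDerivWithinAt) fun s hs => ?_
    have := hle s (interior_subset hs)
    nlinarith [Real.exp_pos (k * s)]
  have h0 := hanti Set.self_mem_Ici ht ht
  simp only [mul_zero, Real.exp_zero, mul_one] at h0
  rwa [neg_mul, Real.exp_neg, ← div_eq_mul_inv, le_div_iff₀ (Real.exp_pos _)]

section Abstract

variable {E : Type*} [NormedAddCommGroup E] [InnerProductSpace ℝ E]

/-- The quadratic form of a bounded operator is bounded by its norm. -/
theorem inner_apply_le_opNorm_mul_sq (T : E →L[ℝ] E) (x : E) : ⟪x, T x⟫ ≤ ‖T‖ * ‖x‖ ^ 2 := by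
  nlinarith [real_inner_le_norm x (T x), T.le_opNorm x, norm_nonneg x]

/-- The energy `⟪I, P I⟫ + ‖h‖² + ⟪ξ, O ξ⟫` with the cross term `2 δ ⟪I, h⟫`, which makes it a
strict Lyapunov function of the closed loop for small `δ`. -/
noncomputable def closedLoopLyapunov (P O : E →L[ℝ] E) (δ : ℝ) (x y z : E) : ℝ :=
  ⟪x, P x⟫ + ⟪y, y⟫ + ⟪z, O z⟫ + 2 * δ * ⟪x, y⟫

theorem closedLoopLyapunov_lower_bound {P O : E →L[ℝ] E} {p o δ : ℝ}
    (hP : ∀ x, p * ‖x‖ ^ 2 ≤ ⟪x, P x⟫) (hO : ∀ x, o * ‖x‖ ^ 2 ≤ ⟪x, O x⟫)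
    (hδ : 0 ≤ δ) (hδp : δ ≤ p / 2) (hδ1 : δ ≤ 1 / 2) (x y z : E) :
    p / 2 * ‖x‖ ^ 2 + 1 / 2 * ‖y‖ ^ 2 + o * ‖z‖ ^ 2 ≤ closedLoopLyapunov P O δ x y z := by
  have hxy : -(2 * ⟪x, y⟫) ≤ ‖x‖ ^ 2 + ‖y‖ ^ 2 := by
    have := (abs_le.1 (abs_real_inner_le_norm x y)).1
    nlinarith [sq_nonneg (‖x‖ - ‖y‖)]
  rw [closedLoopLyapunov, real_inner_self_eq_norm_sq]
  nlinarith [hP x, hO z, mul_le_mul_of_nonneg_left hxy hδ,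
    mul_le_mul_of_nonneg_right hδp (sq_nonneg ‖x‖), mul_le_mul_of_nonneg_right hδ1 (sq_nonneg ‖y‖)]

theorem closedLoopLyapunov_upper_bound (P O : E →L[ℝ] E) {δ : ℝ} (hδ : 0 ≤ δ) (hδ1 : δ ≤ 1 / 2)
    (x y z : E) : closedLoopLyapunov P O δ x y z ≤
      (‖P‖ + ‖O‖ + 2) * (‖x‖ ^ 2 + ‖y‖ ^ 2 + ‖z‖ ^ 2) := by
  have hxy : 2 * ⟪x, y⟫ ≤ ‖x‖ ^ 2 + ‖y‖ ^ 2 := by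
    nlinarith [real_inner_le_norm x y, sq_nonneg (‖x‖ - ‖y‖)]
  have hδxy : δ * (‖x‖ ^ 2 + ‖y‖ ^ 2) ≤ 1 / 2 * (‖x‖ ^ 2 + ‖y‖ ^ 2) := by gcongr
  rw [closedLoopLyapunov, real_inner_self_eq_norm_sq]
  have := mul_nonneg (norm_nonneg P) (sq_nonneg ‖y‖)
  have := mul_nonneg (norm_nonneg P) (sq_nonneg ‖z‖)
  have := mul_nonneg (norm_nonneg O) (sq_nonneg ‖x‖)
  have := mul_nonneg (norm_nonneg O) (sq_nonneg ‖y‖)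
  linarith [inner_apply_le_opNorm_mul_sq P x, inner_apply_le_opNorm_mul_sq O z,
    mul_le_mul_of_nonneg_left hxy hδ, sq_nonneg ‖x‖, sq_nonneg ‖y‖, sq_nonneg ‖z‖]

theorem hasDerivAt_closedLoopLyapunov {P D O Q : E →L[ℝ] E} (hPs : ∀ x y, ⟪P x, y⟫ = ⟪x, P y⟫)
    (hOs : ∀ x y, ⟪O x, y⟫ = ⟪x, O y⟫) (hOQ : ∀ x, O (Q x) = x) (δ : ℝ) {I h ξ : ℝ → E} {t : ℝ}
    (hI : HasDerivAt I (h t) t) (hh : HasDerivAt h (ξ t - D (h t) - P (I t)) t)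
    (hξ : HasDerivAt ξ (-ξ t - Q (h t)) t) :
    HasDerivAt (fun s => closedLoopLyapunov P O δ (I s) (h s) (ξ s))
      (-2 * ⟪h t, D (h t)⟫ - 2 * ⟪ξ t, O (ξ t)⟫ +
        2 * δ * (‖h t‖ ^ 2 + ⟪I t, ξ t⟫ - ⟪I t, D (h t)⟫ - ⟪I t, P (I t)⟫)) t := by
  have hPI : HasDerivAt (fun s => P (I s)) (P (h t)) t := P.hasFDerivAt.comp_hasDerivAt t hI
  have hOξ : HasDerivAt (fun s => O (ξ s)) (O (-ξ t - Q (h t))) t :=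
    O.hasFDerivAt.comp_hasDerivAt t hξ
  have hQO : ⟪Q (h t), O (ξ t)⟫ = ⟪h t, ξ t⟫ := by rw [← hOs, hOQ]
  have hPh : ⟪P (I t), h t⟫ = ⟪I t, P (h t)⟫ := hPs _ _
  refine ((((hI.inner ℝ hPI).add (hh.inner ℝ hh)).add (hξ.inner ℝ hOξ)).add
    ((hI.inner ℝ hh).const_mul (2 * δ))).congr_deriv ?_
  simp only [map_sub, map_neg, hOQ, inner_sub_left, inner_sub_right, inner_neg_left,
    inner_neg_right, real_inner_self_eq_norm_sq, hQO, hPh]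
  rw [real_inner_comm (h t) (ξ t), real_inner_comm (h t) (D (h t))]
  ring

theorem closedLoop_dissipation {P D O : E →L[ℝ] E} {p d o δ : ℝ} (hp : 0 < p)
    (hP : ∀ x, p * ‖x‖ ^ 2 ≤ ⟪x, P x⟫) (hD : ∀ x, d * ‖x‖ ^ 2 ≤ ⟪x, D x⟫)
    (hO : ∀ x, o * ‖x‖ ^ 2 ≤ ⟪x, O x⟫) (hδ : 0 ≤ δ)
    (hδd : δ * (1 + ‖D‖ ^ 2 / p) ≤ d / 2) (hδo : δ * (1 / p) ≤ o / 2) (x y z : E) :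
    -2 * ⟪y, D y⟫ - 2 * ⟪z, O z⟫ + 2 * δ * (‖y‖ ^ 2 + ⟪x, z⟫ - ⟪x, D y⟫ - ⟪x, P x⟫) ≤
      -(δ * p * ‖x‖ ^ 2 + d * ‖y‖ ^ 2 + o * ‖z‖ ^ 2) := by
  have young : ∀ a b : ℝ, a * b ≤ p / 4 * a ^ 2 + 1 / p * b ^ 2 := fun a b => by
    have : p / 4 * a ^ 2 + 1 / p * b ^ 2 - a * b = (p * a - 2 * b) ^ 2 / (4 * p) := by
      field_simp
      ring
    linarith [div_nonneg (sq_nonneg (p * a - 2 * b)) (by positivity : 0 ≤ 4 * p)]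
  have hxz : ⟪x, z⟫ ≤ p / 4 * ‖x‖ ^ 2 + 1 / p * ‖z‖ ^ 2 :=
    (real_inner_le_norm x z).trans (young _ _)
  have hxy : -⟪x, D y⟫ ≤ p / 4 * ‖x‖ ^ 2 + ‖D‖ ^ 2 / p * ‖y‖ ^ 2 := by
    calc -⟪x, D y⟫ ≤ ‖x‖ * ‖D y‖ := by
          linarith [(abs_le.1 (abs_real_inner_le_norm x (D y))).1]
      _ ≤ ‖x‖ * (‖D‖ * ‖y‖) := by gcongr; exact D.le_opNorm y
      _ ≤ _ := (young _ _).trans_eq (by ring)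
  have hcross : δ * (‖y‖ ^ 2 + ⟪x, z⟫ - ⟪x, D y⟫ - ⟪x, P x⟫) ≤
      δ * ((1 + ‖D‖ ^ 2 / p) * ‖y‖ ^ 2 + 1 / p * ‖z‖ ^ 2 - p / 2 * ‖x‖ ^ 2) := by
    refine mul_le_mul_of_nonneg_left ?_ hδ
    linarith [hP x]
  linarith [hD y, hO z, mul_le_mul_of_nonneg_right hδd (sq_nonneg ‖y‖),
    mul_le_mul_of_nonneg_right hδo (sq_nonneg ‖z‖)]

theorem exists_pos_forall_mul_le {a b : ℝ} (ha : 0 < a) (hb : 0 < b) :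
    ∃ ε > 0, ∀ δ ≤ ε, δ * a ≤ b :=
  ⟨b / a, div_pos hb ha, fun _ hδ => (le_div_iff₀ ha).1 hδ⟩

/-- Solutions of the closed loop decay exponentially, uniformly in the initial state. -/
theorem closedLoop_exponential_decay {P D O Q : E →L[ℝ] E} {p d o : ℝ}
    (hp : 0 < p) (hd : 0 < d) (ho : 0 < o)
    (hP : ∀ x, p * ‖x‖ ^ 2 ≤ ⟪x, P x⟫) (hD : ∀ x, d * ‖x‖ ^ 2 ≤ ⟪x, D x⟫)
    (hO : ∀ x, o * ‖x‖ ^ 2 ≤ ⟪x, O x⟫) (hPs : ∀ x y, ⟪P x, y⟫ = ⟪x, P y⟫)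
    (hOs : ∀ x y, ⟪O x, y⟫ = ⟪x, O y⟫) (hOQ : ∀ x, O (Q x) = x) :
    ∃ C > 0, ∃ k > 0, ∀ I h ξ : ℝ → E, (∀ t, 0 ≤ t → HasDerivAt I (h t) t) →
      (∀ t, 0 ≤ t → HasDerivAt h (ξ t - D (h t) - P (I t)) t) →
      (∀ t, 0 ≤ t → HasDerivAt ξ (-ξ t - Q (h t)) t) → ∀ t, 0 ≤ t →
      ‖I t‖ ^ 2 + ‖h t‖ ^ 2 + ‖ξ t‖ ^ 2 ≤
        C * (‖I 0‖ ^ 2 + ‖h 0‖ ^ 2 + ‖ξ 0‖ ^ 2) * Real.exp (-k * t) := by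
  obtain ⟨δ₁, hδ₁, hd'⟩ := exists_pos_forall_mul_le
    (by positivity : 0 < 1 + ‖D‖ ^ 2 / p) (half_pos hd)
  obtain ⟨δ₂, hδ₂, ho'⟩ := exists_pos_forall_mul_le (one_div_pos.2 hp) (half_pos ho)
  obtain ⟨δ, hδ, hδle⟩ : ∃ δ > 0, δ ≤ δ₁ ∧ δ ≤ δ₂ ∧ δ ≤ p / 2 ∧ δ ≤ 1 / 2 :=
    ⟨min (min δ₁ δ₂) (min (p / 2) (1 / 2)), by positivity, by simp, by simp, by simp, by simp⟩
  obtain ⟨hδ1, hδ2, hδp, hδh⟩ := hδle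
  obtain ⟨a, ha, hap, hah, hao⟩ : ∃ a > 0, a ≤ p / 2 ∧ a ≤ 1 / 2 ∧ a ≤ o :=
    ⟨min (p / 2) (min (1 / 2) o), by positivity, by simp, by simp, by simp⟩
  obtain ⟨c, hc, hcp, hcd, hco⟩ : ∃ c > 0, c ≤ δ * p ∧ c ≤ d ∧ c ≤ o :=
    ⟨min (δ * p) (min d o), by positivity, by simp, by simp, by simp⟩
  set b : ℝ := ‖P‖ + ‖O‖ + 2
  have hb : 0 < b := by positivity
  refine ⟨b / a, by positivity, c / b, by positivity, fun I h ξ hI hh hξ t ht => ?_⟩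
  have hupper := fun s => closedLoopLyapunov_upper_bound P O hδ.le hδh (I s) (h s) (ξ s)
  have hdecay := le_mul_exp_neg_of_deriv_le (k := c / b)
    (fun s hs => hasDerivAt_closedLoopLyapunov hPs hOs hOQ δ (hI s hs) (hh s hs) (hξ s hs))
    (fun s _ => by
      refine (closedLoop_dissipation hp hP hD hO hδ.le (hd' δ hδ1) (ho' δ hδ2) _ _ _).trans ?_
      have hcV : c / b * closedLoopLyapunov P O δ (I s) (h s) (ξ s) ≤
          c * (‖I s‖ ^ 2 + ‖h s‖ ^ 2 + ‖ξ s‖ ^ 2) := by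
        calc _ ≤ c / b * (b * (‖I s‖ ^ 2 + ‖h s‖ ^ 2 + ‖ξ s‖ ^ 2)) := by
              gcongr
              exact hupper s
          _ = _ := by field_simp
      linarith [mul_le_mul_of_nonneg_right hcp (sq_nonneg ‖I s‖),
        mul_le_mul_of_nonneg_right hcd (sq_nonneg ‖h s‖),
        mul_le_mul_of_nonneg_right hco (sq_nonneg ‖ξ s‖)]) ht
  have hlower : a * (‖I t‖ ^ 2 + ‖h t‖ ^ 2 + ‖ξ t‖ ^ 2) ≤
      closedLoopLyapunov P O δ (I t) (h t) (ξ t) := by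
    linarith [closedLoopLyapunov_lower_bound hP hO hδ.le hδp hδh (I t) (h t) (ξ t),
      mul_le_mul_of_nonneg_right hap (sq_nonneg ‖I t‖),
      mul_le_mul_of_nonneg_right hah (sq_nonneg ‖h t‖),
      mul_le_mul_of_nonneg_right hao (sq_nonneg ‖ξ t‖)]
  have hinit := mul_le_mul_of_nonneg_right (hupper 0) (Real.exp_pos (-(c / b) * t)).le
  rw [div_mul_eq_mul_div, div_mul_eq_mul_div, le_div_iff₀ ha, mul_comm _ a]
  exact hlower.trans (hdecay.trans hinit)

/-- A continuous linear map on a finite-dimensional space with positive quadratic form is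
coercive. -/
theorem exists_pos_mul_norm_sq_le_inner [FiniteDimensional ℝ E] (T : E →L[ℝ] E)
    (hT : ∀ x, x ≠ 0 → 0 < ⟪x, T x⟫) : ∃ c > 0, ∀ x, c * ‖x‖ ^ 2 ≤ ⟪x, T x⟫ := by
  have : ProperSpace E := FiniteDimensional.proper ℝ E
  obtain ⟨c, hc, hcT⟩ := (isCompact_sphere (0 : E) 1).exists_forall_le'
    (f := fun x => ⟪x, T x⟫) (a := 0) (by fun_prop)
    fun x hx => hT x (ne_zero_of_mem_unit_sphere ⟨x, hx⟩)
  refine ⟨c, hc, fun x => ?_⟩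
  rcases eq_or_ne x 0 with rfl | hx
  · simp
  have hnorm : 0 < ‖x‖ := norm_pos_iff.2 hx
  have := hcT (‖x‖⁻¹ • x) (by simp [norm_smul, hnorm.ne'])
  rw [map_smul, real_inner_smul_left, real_inner_smul_right] at this
  calc c * ‖x‖ ^ 2 ≤ ‖x‖⁻¹ * (‖x‖⁻¹ * ⟪x, T x⟫) * ‖x‖ ^ 2 := by gcongr
    _ = ⟪x, T x⟫ := by field_simp

end Abstract

section Matrices

variable {n : Type*} [Fintype n] [DecidableEq n]

theorem Matrix.PosDef.exists_pos_mul_norm_sq_le_inner {K : Matrix n n ℝ} (hK : K.PosDef) :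
    ∃ c > 0, ∀ x, c * ‖x‖ ^ 2 ≤ ⟪x, (toEuclideanLin K).toContinuousLinearMap x⟫ := by
  refine _root_.exists_pos_mul_norm_sq_le_inner _ fun x hx => ?_
  have := hK.dotProduct_mulVec_pos (x := x.ofLp) (by simpa using hx)
  simpa [EuclideanSpace.inner_eq_star_dotProduct, toLpLin_apply, dotProduct_comm] using this

theorem Matrix.PosDef.inner_toEuclideanLin_left {K : Matrix n n ℝ} (hK : K.PosDef)
    (x y : EuclideanSpace ℝ n) :
    ⟪(toEuclideanLin K).toContinuousLinearMap x, y⟫ =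
      ⟪x, (toEuclideanLin K).toContinuousLinearMap y⟫ :=
  isSymmetric_toEuclideanLin_iff.2 hK.isHermitian x y

theorem Matrix.PosDef.toEuclideanLin_apply_inv {K : Matrix n n ℝ} (hK : K.PosDef)
    (x : EuclideanSpace ℝ n) : (toEuclideanLin K).toContinuousLinearMap
      ((toEuclideanLin K⁻¹).toContinuousLinearMap x) = x := by
  simp [toLpLin_apply, mulVec_mulVec, mul_nonsing_inv K ((isUnit_iff_isUnit_det K).1 hK.isUnit)]

end Matrices

/-- The squared sup-product norm is bounded by the sum of the squared norms. -/
theorem norm_prod_sq_le {E : Type*} [SeminormedAddCommGroup E] (x y z : E) :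
    ‖(x, y, z)‖ ^ 2 ≤ ‖x‖ ^ 2 + ‖y‖ ^ 2 + ‖z‖ ^ 2 := by
  have := sq_nonneg ‖x‖
  have := sq_nonneg ‖y‖
  have := sq_nonneg ‖z‖
  rw [Prod.norm_mk, Prod.norm_mk]
  rcases max_choice ‖x‖ (max ‖y‖ ‖z‖) with h | h <;> rcases max_choice ‖y‖ ‖z‖ with h' | h' <;>
    rw [h] <;> first | linarith | (rw [h']; linarith)

/-- **Theorem 1**: global asymptotic stability of the origin for the closed-loop
momentum-error system: every solution converges to the origin, and the origin is
Lyapunov stable. -/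
theorem closedLoop_globally_asymptotically_stable
    (KP KD KO : Matrix (Fin 6) (Fin 6) ℝ)
    (hKP : KP.PosDef) (hKD : KD.PosDef) (hKO : KO.PosDef) :
    (∀ I h ξ : ℝ → EuclideanSpace ℝ (Fin 6),
      IsClosedLoopSolution KP KD KO I h ξ →
      Tendsto (fun t => (I t, h t, ξ t)) atTop
        (nhds ((0, 0, 0) : EuclideanSpace ℝ (Fin 6) × EuclideanSpace ℝ (Fin 6) ×
          EuclideanSpace ℝ (Fin 6)))) ∧
    (∀ ε : ℝ, 0 < ε → ∃ η : ℝ, 0 < η ∧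
      ∀ I h ξ : ℝ → EuclideanSpace ℝ (Fin 6),
        IsClosedLoopSolution KP KD KO I h ξ →
        ‖(I 0, h 0, ξ 0)‖ < η →
        ∀ t : ℝ, 0 ≤ t → ‖(I t, h t, ξ t)‖ < ε) := by
  obtain ⟨p, hp, hP⟩ := hKP.exists_pos_mul_norm_sq_le_inner
  obtain ⟨d, hd, hD⟩ := hKD.exists_pos_mul_norm_sq_le_inner
  obtain ⟨o, ho, hO⟩ := hKO.exists_pos_mul_norm_sq_le_inner
  obtain ⟨C, hC, k, hk, hdecay⟩ := closedLoop_exponential_decay hp hd ho hP hD hO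
    hKP.inner_toEuclideanLin_left hKO.inner_toEuclideanLin_left hKO.toEuclideanLin_apply_inv
  have hbound : ∀ I h ξ, IsClosedLoopSolution KP KD KO I h ξ → ∀ t, 0 ≤ t →
      ‖(I t, h t, ξ t)‖ ^ 2 ≤
        C * (‖I 0‖ ^ 2 + ‖h 0‖ ^ 2 + ‖ξ 0‖ ^ 2) * Real.exp (-k * t) :=
    fun I h ξ hsol t ht =>
      (norm_prod_sq_le _ _ _).trans (hdecay I h ξ hsol.1 hsol.2.1 hsol.2.2 t ht)
  refine ⟨fun I h ξ hsol => ?_, fun ε hε => ?_⟩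
  · have hexp : Tendsto (fun t : ℝ => Real.exp (-k * t)) atTop (nhds 0) :=
      Real.tendsto_exp_atBot.comp (tendsto_id.const_mul_atTop_of_neg (neg_neg_of_pos hk))
    have hsq : Tendsto (fun t => ‖(I t, h t, ξ t)‖ ^ 2) atTop (nhds 0) := by
      refine tendsto_of_tendsto_of_tendsto_of_le_of_le' tendsto_const_nhds
        (by simpa only [mul_zero] using
          hexp.const_mul (C * (‖I 0‖ ^ 2 + ‖h 0‖ ^ 2 + ‖ξ 0‖ ^ 2)))
        (Eventually.of_forall fun t => sq_nonneg _) ?_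
      filter_upwards [eventually_ge_atTop 0] with t ht using hbound I h ξ hsol t ht
    exact tendsto_zero_iff_norm_tendsto_zero.2 (by simpa using hsq.sqrt)
  · refine ⟨ε / √(3 * C), by positivity, fun I h ξ hsol hinit t ht => ?_⟩
    set r := ‖(I 0, h 0, ξ 0)‖
    have hr : 3 * C * r ^ 2 < ε ^ 2 := by
      have := pow_lt_pow_left₀ hinit (norm_nonneg _) two_ne_zero
      rwa [div_pow, Real.sq_sqrt (by positivity), lt_div_iff₀ (by positivity), mul_comm] at this
    have hI : ‖I 0‖ ≤ r := norm_fst_le (I 0, h 0, ξ 0)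
    have htail : ‖(h 0, ξ 0)‖ ≤ r := norm_snd_le (I 0, h 0, ξ 0)
    have hh : ‖h 0‖ ≤ r := (norm_fst_le (h 0, ξ 0)).trans htail
    have hξ : ‖ξ 0‖ ≤ r := (norm_snd_le (h 0, ξ 0)).trans htail
    refine lt_of_pow_lt_pow_left₀ 2 hε.le ?_
    calc ‖(I t, h t, ξ t)‖ ^ 2
        ≤ C * (‖I 0‖ ^ 2 + ‖h 0‖ ^ 2 + ‖ξ 0‖ ^ 2) * Real.exp (-k * t) := hbound I h ξ hsol t ht
      _ ≤ C * (r ^ 2 + r ^ 2 + r ^ 2) * 1 := by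
          gcongr
          exact Real.exp_le_one_iff.2 (by nlinarith)
      _ = 3 * C * r ^ 2 := by ring
      _ < ε ^ 2 := hr
end

section
/- Boundedness of closed-loop trajectories: for any symmetric positive definite K_P, K_D, K_O ∈ ℝ^{6×6} and any solution (I, h̃, ξ̃) of the closed-loop momentum-error system, there exists a constant C ≥ 0 (depending on the initial condition) such that ‖I(t)‖ ≤ C, ‖h̃(t)‖ ≤ C, and ‖ξ̃(t)‖ ≤ C for all t ≥ 0. -/
open Filter Matrix

section QuadraticForms

variable {n : Type*} [Fintype n] [DecidableEq n] {K : Matrix n n ℝ}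

theorem Matrix.PosDef.inner_toEuclideanLin_pos (hK : K.PosDef) {x : EuclideanSpace ℝ n}
    (hx : x ≠ 0) : 0 < inner ℝ (Matrix.toEuclideanLin K x) x := by
  have hpos := hK.dotProduct_mulVec_pos (x := x.ofLp) (by simpa using hx)
  simpa [EuclideanSpace.inner_eq_star_dotProduct] using hpos

theorem Matrix.PosDef.inner_toEuclideanLin_nonneg (hK : K.PosDef) (x : EuclideanSpace ℝ n) :
    0 ≤ inner ℝ (Matrix.toEuclideanLin K x) x := by
  rcases eq_or_ne x 0 with rfl | hx
  · simp
  · exact (hK.inner_toEuclideanLin_pos hx).le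

/-- The quadratic form of a positive definite matrix is coercive. -/
theorem Matrix.PosDef.exists_mul_norm_sq_le (hK : K.PosDef) :
    ∃ c : ℝ, 0 < c ∧
      ∀ x : EuclideanSpace ℝ n, c * ‖x‖ ^ 2 ≤ inner ℝ (Matrix.toEuclideanLin K x) x := by
  have hcont : Continuous fun x : EuclideanSpace ℝ n ↦ inner ℝ (Matrix.toEuclideanLin K x) x :=
    (LinearMap.continuous_of_finiteDimensional _).inner continuous_id
  rcases (Metric.sphere (0 : EuclideanSpace ℝ n) 1).eq_empty_or_nonempty with hempty | hne
  · refine ⟨1, one_pos, fun x ↦ ?_⟩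
    rcases eq_or_ne x 0 with rfl | hx
    · simp
    · have hmem : ‖x‖⁻¹ • x ∈ Metric.sphere (0 : EuclideanSpace ℝ n) 1 := by
        simp [norm_smul, hx]
      simp [hempty] at hmem
  · obtain ⟨y, hy, hmin⟩ := (isCompact_sphere _ _).exists_isMinOn hne hcont.continuousOn
    have hy0 : y ≠ 0 := by
      rintro rfl
      simp at hy
    refine ⟨_, hK.inner_toEuclideanLin_pos hy0, fun x ↦ ?_⟩
    rcases eq_or_ne x 0 with rfl | hx
    · simp
    · have hle := hmin (a := ‖x‖⁻¹ • x) (by simp [norm_smul, hx])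
      simp only [Set.mem_ofPred_eq, map_smul, real_inner_smul_left, real_inner_smul_right] at hle
      have hnorm : 0 < ‖x‖ := norm_pos_iff.mpr hx
      calc _ ≤ ‖x‖⁻¹ * (‖x‖⁻¹ * inner ℝ (Matrix.toEuclideanLin K x) x) * ‖x‖ ^ 2 := by gcongr
        _ = _ := by field_simp

/-- A bound on the quadratic form of a positive definite matrix bounds the norm. -/
theorem Matrix.PosDef.exists_norm_le (hK : K.PosDef) (V : ℝ) :
    ∃ C : ℝ, 0 ≤ C ∧ ∀ x : EuclideanSpace ℝ n,
      inner ℝ (Matrix.toEuclideanLin K x) x ≤ V → ‖x‖ ≤ C := by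
  obtain ⟨c, hc, hcoer⟩ := hK.exists_mul_norm_sq_le
  refine ⟨√(V / c), Real.sqrt_nonneg _, fun x hx ↦ Real.le_sqrt_of_sq_le ?_⟩
  rw [le_div_iff₀' hc]
  exact (hcoer x).trans hx

theorem Matrix.IsHermitian.hasDerivAt_inner_toEuclideanLin (hK : K.IsHermitian)
    {f : ℝ → EuclideanSpace ℝ n} {f' : EuclideanSpace ℝ n} {t : ℝ} (hf : HasDerivAt f f' t) :
    HasDerivAt (fun s ↦ inner ℝ (Matrix.toEuclideanLin K (f s)) (f s))
      (2 * inner ℝ (Matrix.toEuclideanLin K (f t)) f') t := by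
  have hKf : HasDerivAt (fun s ↦ Matrix.toEuclideanLin K (f s)) (Matrix.toEuclideanLin K f') t :=
    (LinearMap.toContinuousLinearMap (Matrix.toEuclideanLin K)).hasFDerivAt.comp_hasDerivAt t hf
  refine (hKf.inner ℝ hf).congr_deriv ?_
  rw [Matrix.isSymmetric_toEuclideanLin_iff.mpr hK f' (f t), real_inner_comm]
  ring

end QuadraticForms

/-- The Lyapunov function `⟨K_P I, I⟩ + ‖h̃‖² + ⟨K_O ξ̃, ξ̃⟩` of the closed-loop system. -/
noncomputable def lyapunov (KP KO : Matrix (Fin 6) (Fin 6) ℝ)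
    (x y z : EuclideanSpace ℝ (Fin 6)) : ℝ :=
  inner ℝ (Matrix.toEuclideanLin KP x) x + ‖y‖ ^ 2 + inner ℝ (Matrix.toEuclideanLin KO z) z

theorem IsClosedLoopSolution.hasDerivAt_lyapunov {KP KD KO : Matrix (Fin 6) (Fin 6) ℝ}
    {I h ξ : ℝ → EuclideanSpace ℝ (Fin 6)} (hsol : IsClosedLoopSolution KP KD KO I h ξ)
    (hKP : KP.IsHermitian) (hKO : KO.PosDef) {t : ℝ} (ht : 0 ≤ t) :
    HasDerivAt (fun s ↦ lyapunov KP KO (I s) (h s) (ξ s))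
      (-2 * (inner ℝ (Matrix.toEuclideanLin KD (h t)) (h t) +
        inner ℝ (Matrix.toEuclideanLin KO (ξ t)) (ξ t))) t := by
  obtain ⟨hI, hh, hξ⟩ := hsol
  have hcancel : inner ℝ (Matrix.toEuclideanLin KO (ξ t)) (Matrix.toEuclideanLin KO⁻¹ (h t)) =
      inner ℝ (ξ t) (h t) := by
    rw [Matrix.isSymmetric_toEuclideanLin_iff.mpr hKO.isHermitian]
    congr 1
    simp [Matrix.toLpLin_apply, Matrix.mulVec_mulVec,
      Matrix.mul_nonsing_inv _ ((Matrix.isUnit_iff_isUnit_det KO).mp hKO.isUnit)]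
  refine (((hKP.hasDerivAt_inner_toEuclideanLin (hI t ht)).add (hh t ht).norm_sq).add
    (hKO.isHermitian.hasDerivAt_inner_toEuclideanLin (hξ t ht))).congr_deriv ?_
  simp only [act, inner_sub_right, inner_neg_right, hcancel]
  rw [real_inner_comm (h t) (ξ t), real_inner_comm (h t) (Matrix.toEuclideanLin KD (h t)),
    real_inner_comm (h t) (Matrix.toEuclideanLin KP (I t))]
  ring

theorem IsClosedLoopSolution.lyapunov_le {KP KD KO : Matrix (Fin 6) (Fin 6) ℝ}
    {I h ξ : ℝ → EuclideanSpace ℝ (Fin 6)} (hsol : IsClosedLoopSolution KP KD KO I h ξ)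
    (hKP : KP.IsHermitian) (hKD : KD.PosDef) (hKO : KO.PosDef) {t : ℝ} (ht : 0 ≤ t) :
    lyapunov KP KO (I t) (h t) (ξ t) ≤ lyapunov KP KO (I 0) (h 0) (ξ 0) := by
  have hderiv := fun (s : ℝ) (hs : 0 ≤ s) ↦ hsol.hasDerivAt_lyapunov hKP hKO hs
  refine antitoneOn_of_hasDerivWithinAt_nonpos (convex_Ici (0 : ℝ))
    (fun s hs ↦ (hderiv s hs).continuousAt.continuousWithinAt)
    (fun s hs ↦ (hderiv s (interior_subset hs)).hasDerivWithinAt)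
    (fun s _ ↦ ?_) Set.self_mem_Ici ht ht
  linarith [hKD.inner_toEuclideanLin_nonneg (h s), hKO.inner_toEuclideanLin_nonneg (ξ s)]

/-- Boundedness of closed-loop trajectories: every solution of the closed-loop
momentum-error system is bounded on `[0, ∞)`. -/
theorem closedLoop_trajectories_bounded
    (KP KD KO : Matrix (Fin 6) (Fin 6) ℝ)
    (hKP : KP.PosDef) (hKD : KD.PosDef) (hKO : KO.PosDef)
    (I h ξ : ℝ → EuclideanSpace ℝ (Fin 6))
    (hsol : IsClosedLoopSolution KP KD KO I h ξ) :
    ∃ C : ℝ, 0 ≤ C ∧ ∀ t : ℝ, 0 ≤ t → ‖I t‖ ≤ C ∧ ‖h t‖ ≤ C ∧ ‖ξ t‖ ≤ C := by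
  set V := lyapunov KP KO (I 0) (h 0) (ξ 0) with hV
  obtain ⟨CI, hCI, hIle⟩ := hKP.exists_norm_le V
  obtain ⟨Cξ, hCξ, hξle⟩ := hKO.exists_norm_le V
  have hCh : 0 ≤ √V := Real.sqrt_nonneg V
  refine ⟨CI + √V + Cξ, by positivity, fun t ht ↦ ?_⟩
  have hle := hsol.lyapunov_le hKP.isHermitian hKD hKO ht
  rw [← hV, lyapunov] at hle
  have hI := hKP.inner_toEuclideanLin_nonneg (I t)
  have hξ := hKO.inner_toEuclideanLin_nonneg (ξ t)
  have hh := sq_nonneg ‖h t‖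
  have hhle : ‖h t‖ ≤ √V := Real.le_sqrt_of_sq_le (by linarith)
  refine ⟨(hIle (I t) (by linarith)).trans (by linarith), by linarith,
    (hξle (ξ t) (by linarith)).trans (by linarith)⟩
end

section
/- Characterization of the invariant set where the Lyapunov derivative vanishes: if (I, h̃, ξ̃) is a solution of the closed-loop momentum-error system with h̃(t) = 0 for all t ≥ 0, then also ξ̃(t) = 0 and I(t) = 0 for all t ≥ 0. -/
open Filter Matrix

/-- Two functions that agree to the right of a point have the same derivative there. -/
lemma HasDerivAt.eq_of_eqOn_Ici {E : Type*} [NormedAddCommGroup E] [NormedSpace ℝ E]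
    {f g : ℝ → E} {f' g' : E} {t : ℝ} (hf : HasDerivAt f f' t) (hg : HasDerivAt g g' t)
    (hfg : Set.EqOn f g (Set.Ici t)) : f' = g' :=
  (uniqueDiffWithinAt_Ici t).eq_deriv _ hf.hasDerivWithinAt
    (hg.hasDerivWithinAt.congr hfg (hfg Set.self_mem_Ici))

lemma HasDerivAt.act {K : Matrix (Fin 6) (Fin 6) ℝ} {f : ℝ → EuclideanSpace ℝ (Fin 6)}
    {f' : EuclideanSpace ℝ (Fin 6)} {t : ℝ} (hf : HasDerivAt f f' t) :
    HasDerivAt (fun s => _root_.act K (f s)) (_root_.act K f') t :=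
  (Matrix.toEuclideanLin K).toContinuousLinearMap.hasFDerivAt.comp_hasDerivAt t hf

lemma act_zero (K : Matrix (Fin 6) (Fin 6) ℝ) : act K 0 = 0 :=
  map_zero (Matrix.toEuclideanLin K)

lemma eq_zero_of_act_eq_zero {K : Matrix (Fin 6) (Fin 6) ℝ} (hK : IsUnit K)
    {x : EuclideanSpace ℝ (Fin 6)} (hx : act K x = 0) : x = 0 := by
  have hmul : K *ᵥ x.ofLp = K *ᵥ 0 := by
    rw [Matrix.mulVec_zero]
    exact congrArg WithLp.ofLp hx
  exact WithLp.ofLp_injective 2 (Matrix.mulVec_injective_of_isUnit hK hmul)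

/-- Characterization of the invariant set where the Lyapunov derivative vanishes:
a solution with `h̃ ≡ 0` on `[0, ∞)` also has `ξ̃ ≡ 0` and `I ≡ 0` there. -/
theorem invariant_set_is_origin
    (KP KD KO : Matrix (Fin 6) (Fin 6) ℝ)
    (hKP : KP.PosDef) (hKD : KD.PosDef) (hKO : KO.PosDef)
    (I h ξ : ℝ → EuclideanSpace ℝ (Fin 6))
    (hsol : IsClosedLoopSolution KP KD KO I h ξ)
    (hzero : ∀ t : ℝ, 0 ≤ t → h t = 0) :
    ∀ t : ℝ, 0 ≤ t → ξ t = 0 ∧ I t = 0 := by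
  obtain ⟨hI, hh, hξ⟩ := hsol
  have hξI : ∀ t : ℝ, 0 ≤ t → ξ t = act KP (I t) := fun t ht => by
    have hderiv := (hh t ht).eq_of_eqOn_Ici (hasDerivAt_const t 0)
      fun s hs => hzero s (ht.trans hs)
    rwa [hzero t ht, act_zero, sub_zero, sub_eq_zero] at hderiv
  intro t ht
  have hξt : ξ t = 0 := by
    have hderiv := (hξ t ht).eq_of_eqOn_Ici (hI t ht).act fun s hs => hξI s (ht.trans hs)
    rwa [hzero t ht, act_zero, act_zero, sub_zero, neg_eq_zero] at hderiv
  exact ⟨hξt, eq_zero_of_act_eq_zero hKP.isUnit ((hξI t ht).symm.trans hξt)⟩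
end
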